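/- Let 0 < p < 2 and let g = (g_ν)_{ν ∈ F} be a real family with ∑_{ν ∈ F} |g_ν|^p < ∞, and let F_fun = ∑_{ν ∈ F} g_ν T_ν, the series converging in L²(U,η). Then for every integer s ≥ 1 there exists a finite set S ⊂ F with #S = s such that ‖F_fun - ∑_{ν ∈ S} g_ν T_ν‖_{L²(U,η)} ≤ s^{1/2 - 1/p} (∑_{ν ∈ F} |g_ν|^p)^{1/p}. -/

import Mathlib

open MeasureTheory

/-- The L²-normalized Chebyshev polynomials: `T 0 = 1`, `T n t = √2 cos (n arccos t)`. -/
noncomputable def chebFun (n : ℕ) (t : ℝ) : ℝ :=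
  if n = 0 then 1 else Real.sqrt 2 * Real.cos (n * Real.arccos t)

/-- The Chebyshev (arcsine) probability measure `dσ(t) = dt/(π √(1-t²))` on `(-1,1)`. -/
noncomputable def chebMeasure : Measure ℝ :=
  (volume.restrict (Set.Ioo (-1 : ℝ) 1)).withDensity
    (fun t => ENNReal.ofReal (1 / (Real.pi * Real.sqrt (1 - t ^ 2))))

/-- `η` is the countable product of the Chebyshev measures. -/
def IsChebProductMeasure (η : Measure (ℕ → ℝ)) : Prop :=
  IsProbabilityMeasure η ∧
    ∀ (s : Finset ℕ) (B : ℕ → Set ℝ), (∀ i, MeasurableSet (B i)) →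
      η {y | ∀ i ∈ s, y i ∈ B i} = ∏ i ∈ s, chebMeasure (B i)

open Polynomial.Chebyshev in
theorem chebMeasure_eq_smul_measureT :
    chebMeasure = ENNReal.ofReal Real.pi⁻¹ • measureT := by
  rw [chebMeasure, measureT, restrict_withDensity (by measurability),
    Measure.restrict_congr_set Ioo_ae_eq_Ioc, ← withDensity_smul _ (by fun_prop)]
  congr 1
  ext t
  rw [Pi.smul_apply, smul_eq_mul, one_div, mul_inv, ENNReal.ofReal_mul (by positivity),
    ← Real.sqrt_inv]
  congr 1
  exact ENNReal.ofReal_eq_coe_nnreal (by positivity)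

open Polynomial.Chebyshev in
theorem chebFun_eq_T_eval (n : ℕ) {t : ℝ} (ht : t ∈ Set.Icc (-1 : ℝ) 1) :
    chebFun n t = (if n = 0 then 1 else √2) * (T ℝ n).eval t := by
  rw [← Real.cos_arccos ht.1 ht.2, T_real_cos, chebFun,
    Real.arccos_cos (Real.arccos_nonneg t) (Real.arccos_le_pi t)]
  split_ifs with h <;> simp [h]

theorem measurable_chebFun (n : ℕ) : Measurable (chebFun n) := by
  unfold chebFun
  split_ifs <;> fun_prop

open Polynomial.Chebyshev in
/-- The univariate normalized Chebyshev polynomials are orthonormal. -/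
theorem integral_chebFun_mul_chebFun (m n : ℕ) :
    ∫ t, chebFun m t * chebFun n t ∂chebMeasure = if m = n then 1 else 0 := by
  have hT : ∫ t, chebFun m t * chebFun n t ∂measureT =
      ∫ t, (((if m = 0 then 1 else √2) * (if n = 0 then 1 else √2)) *
        ((T ℝ m).eval t * (T ℝ n).eval t)) ∂measureT := by
    refine integral_congr_ae ?_
    rw [measureT]
    filter_upwards [ae_restrict_mem measurableSet_Ioc] with t ht
    rw [chebFun_eq_T_eval m ⟨ht.1.le, ht.2⟩, chebFun_eq_T_eval n ⟨ht.1.le, ht.2⟩]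
    ring
  rw [chebMeasure_eq_smul_measureT, integral_smul_measure, hT, integral_const_mul,
    ENNReal.toReal_ofReal (by positivity), smul_eq_mul]
  have hpi := Real.pi_ne_zero
  rcases eq_or_ne m n with rfl | h
  · rcases eq_or_ne m 0 with rfl | h₀
    · simp only [Nat.cast_zero, integral_eval_T_real_mul_self_measureT_zero, if_true]
      field_simp
    · rw [integral_T_real_mul_self_measureT_of_ne_zero h₀, if_neg h₀, if_pos rfl,
        Real.mul_self_sqrt (by norm_num)]
      field_simp
  · rw [integral_eval_T_real_mul_eval_T_real_measureT_of_ne h, if_neg h, mul_zero, mul_zero]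

theorem IsChebProductMeasure.isProbabilityMeasure_chebMeasure {η : Measure (ℕ → ℝ)}
    (hη : IsChebProductMeasure η) : IsProbabilityMeasure chebMeasure := by
  have := hη.1
  exact ⟨by simpa using (hη.2 {0} (fun _ => Set.univ) fun _ => .univ).symm⟩

theorem IsChebProductMeasure.integral_prod {η : Measure (ℕ → ℝ)} (hη : IsChebProductMeasure η)
    (s : Finset ℕ) {f : ℕ → ℝ → ℝ} (hf : ∀ i, Measurable (f i)) :
    ∫ y, ∏ i ∈ s, f i (y i) ∂η = ∏ i ∈ s, ∫ t, f i t ∂chebMeasure := by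
  have := hη.isProbabilityMeasure_chebMeasure
  rw [Measure.eq_infinitePi (fun _ : ℕ => chebMeasure) (ν := η) hη.2]
  have hmeas : Measurable fun z : s → ℝ => ∏ i : s, f i (z i) := by fun_prop
  have h := integral_restrict_infinitePi (fun _ : ℕ => chebMeasure)
    hmeas.aestronglyMeasurable
  rw [integral_fintype_prod_eq_prod (f := fun i : s => f i)] at h
  rw [← Finset.prod_coe_sort s fun i => ∫ t, f i t ∂chebMeasure, ← h]
  congr 1 with y
  exact (Finset.prod_coe_sort s fun i => f i (y i)).symm

/-- The tensorized Chebyshev polynomials are orthonormal in `L²(U, η)`. -/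
theorem IsChebProductMeasure.orthonormal {η : Measure (ℕ → ℝ)} (hη : IsChebProductMeasure η)
    {TL : (ℕ →₀ ℕ) → Lp ℝ 2 η}
    (hTL : ∀ ν : ℕ →₀ ℕ,
      (TL ν : (ℕ → ℝ) → ℝ) =ᵐ[η] fun y => ∏ j ∈ ν.support, chebFun (ν j) (y j)) :
    Orthonormal ℝ TL := by
  rw [orthonormal_iff_ite]
  intro μ ν
  have hext : ∀ (κ : ℕ →₀ ℕ) (s : Finset ℕ), κ.support ⊆ s → ∀ y : ℕ → ℝ,
      ∏ j ∈ κ.support, chebFun (κ j) (y j) = ∏ j ∈ s, chebFun (κ j) (y j) :=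
    fun κ s hs y => Finset.prod_subset hs fun j _ hj => by
      rw [Finsupp.notMem_support_iff.mp hj, chebFun, if_pos rfl]
  rw [L2.inner_def]
  have hint : ∫ y, inner ℝ (TL μ y) (TL ν y) ∂η =
      ∫ y, ∏ j ∈ μ.support ∪ ν.support, (chebFun (μ j) (y j) * chebFun (ν j) (y j)) ∂η := by
    refine integral_congr_ae ?_
    filter_upwards [hTL μ, hTL ν] with y h₁ h₂
    rw [h₁, h₂, hext μ (μ.support ∪ ν.support) Finset.subset_union_left,
      hext ν (μ.support ∪ ν.support) Finset.subset_union_right,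
      Finset.prod_mul_distrib]
    simp [mul_comm]
  rw [hint, hη.integral_prod _ (f := fun j t => chebFun (μ j) t * chebFun (ν j) t)
    fun j => (measurable_chebFun _).mul (measurable_chebFun _)]
  simp_rw [integral_chebFun_mul_chebFun]
  split_ifs with h
  · simp [h]
  · obtain ⟨j, hj⟩ := Finsupp.ne_iff.mp h
    refine Finset.prod_eq_zero (i := j) ?_ (if_neg hj)
    by_contra hmem
    simp only [Finset.mem_union, Finsupp.mem_support_iff, not_or, not_not] at hmem
    exact hj (hmem.1.trans hmem.2.symm)

/-- A nonnegative summable family on an infinite type has a set of `s` largest values. -/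
theorem Summable.exists_card_eq_forall_notMem_le {ι : Type*} [Infinite ι] {f : ι → ℝ}
    (hf : Summable f) (hf0 : ∀ i, 0 ≤ f i) (s : ℕ) :
    ∃ S : Finset ι, S.card = s ∧ ∀ i ∈ S, ∀ j ∉ S, f j ≤ f i := by
  classical
  induction s with
  | zero => exact ⟨∅, by simp⟩
  | succ s ih =>
    obtain ⟨S, hcard, hS⟩ := ih
    obtain ⟨m, hm, hmax⟩ : ∃ m ∉ S, ∀ j ∉ S, f j ≤ f m := by
      by_cases h : ∃ k ∉ S, 0 < f k
      · obtain ⟨k, hk, hfk⟩ := h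
        have hfin : {j | f k ≤ f j}.Finite := by
          have := hf.tendsto_cofinite_zero.eventually (gt_mem_nhds hfk)
          simpa [Filter.eventually_cofinite] using this
        obtain ⟨m, hm, hmax⟩ := (hfin.toFinset \ S).exists_max_image f ⟨k, by simp [hk]⟩
        simp only [Finset.mem_sdiff, Set.Finite.mem_toFinset, Set.mem_ofPred_eq] at hm hmax
        refine ⟨m, hm.2, fun j hj => ?_⟩
        rcases le_total (f k) (f j) with hkj | hkj
        · exact hmax j ⟨hkj, hj⟩
        · exact hkj.trans hm.1
      · push Not at h
        obtain ⟨m, hm⟩ := Infinite.exists_notMem_finset S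
        exact ⟨m, hm, fun j hj => (h j hj).trans (hf0 m)⟩
    refine ⟨insert m S, by rw [Finset.card_insert_of_notMem hm, hcard], fun i hi j hj => ?_⟩
    rw [Finset.mem_insert, not_or] at hj
    rcases Finset.mem_insert.mp hi with rfl | hi
    · exact hmax j hj.2
    · exact hS i hi j hj.2

theorem Orthonormal.norm_sum_smul_sq {ι E : Type*} [NormedAddCommGroup E]
    [InnerProductSpace ℝ E] {e : ι → E} (he : Orthonormal ℝ e) (g : ι → ℝ) (T : Finset ι) :
    ‖∑ i ∈ T, g i • e i‖ ^ 2 = ∑ i ∈ T, g i ^ 2 := by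
  rw [← real_inner_self_eq_norm_sq, he.inner_sum]
  simp [sq]

/-- Stechkin's inequality for best `s`-term approximation from an orthonormal family. -/
theorem Orthonormal.exists_card_eq_norm_sub_sum_le {ι E : Type*} [Infinite ι]
    [NormedAddCommGroup E] [InnerProductSpace ℝ E] {e : ι → E} (he : Orthonormal ℝ e)
    {p : ℝ} (hp0 : 0 < p) (hp2 : p < 2) {g : ι → ℝ} (hg : Summable fun i => |g i| ^ p)
    {x : E} (hx : HasSum (fun i => g i • e i) x) {s : ℕ} (hs : 1 ≤ s) :
    ∃ S : Finset ι, S.card = s ∧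
      ‖x - ∑ i ∈ S, g i • e i‖ ≤
        (s : ℝ) ^ ((1 : ℝ) / 2 - 1 / p) * (∑' i, |g i| ^ p) ^ (1 / p) := by
  classical
  have hf0 : ∀ i, 0 ≤ |g i| ^ p := fun i => by positivity
  obtain ⟨S, hcard, hS⟩ := hg.exists_card_eq_forall_notMem_le hf0 s
  refine ⟨S, hcard, ?_⟩
  set A := ∑' i, |g i| ^ p with hA
  have hA0 : 0 ≤ A := tsum_nonneg hf0
  have hs0 : (0 : ℝ) < s := by exact_mod_cast hs
  have htail : ∀ j ∉ S, |g j| ^ p ≤ A / s := fun j hj => by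
    rw [le_div_iff₀ hs0]
    calc |g j| ^ p * s = ∑ _i ∈ S, |g j| ^ p := by
          rw [Finset.sum_const, hcard, nsmul_eq_mul, mul_comm]
      _ ≤ ∑ i ∈ S, |g i| ^ p := Finset.sum_le_sum fun i hi => hS i hi j hj
      _ ≤ A := hg.sum_le_tsum _ fun i _ => hf0 i
  have hsq : ∀ j ∉ S, g j ^ 2 ≤ (A / s) ^ (2 / p - 1) * |g j| ^ p := fun j hj => by
    have hpos : 0 < 2 / p - 1 := by rw [sub_pos, lt_div_iff₀ hp0]; linarith
    calc g j ^ 2 = (|g j| ^ p) ^ (2 / p - 1) * |g j| ^ p := by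
          rw [← Real.rpow_add_one' (hf0 j) (by linarith [div_pos two_pos hp0]),
            ← Real.rpow_mul (abs_nonneg _), ← sq_abs, ← Real.rpow_two]
          congr 1
          field_simp
          ring
      _ ≤ _ := by gcongr; exact htail j hj
  have hbound : ((s : ℝ) ^ ((1 : ℝ) / 2 - 1 / p) * A ^ (1 / p)) ^ 2 =
      (A / s) ^ (2 / p - 1) * A := by
    have hA2 : A ^ (2 / p) = A ^ (2 / p - 1) * A := by
      rw [← Real.rpow_add_one' hA0 (by simpa using hp0.ne'), sub_add_cancel]
    rw [mul_pow, ← Real.rpow_two, ← Real.rpow_two, ← Real.rpow_mul hs0.le,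
      ← Real.rpow_mul hA0, Real.div_rpow hA0 hs0.le, one_div_mul_eq_div, hA2,
      div_mul_eq_mul_div, div_eq_mul_inv _ ((s : ℝ) ^ _), ← Real.rpow_neg hs0.le, mul_comm]
    congr 2
    ring
  have hlim := (hx.sub_const (∑ i ∈ S, g i • e i)).norm
  refine le_of_tendsto hlim ?_
  filter_upwards [Filter.eventually_ge_atTop S] with T hT
  refine le_of_sq_le_sq ?_ (by positivity)
  rw [hbound, ← Finset.sum_sdiff_eq_sub hT, he.norm_sum_smul_sq]
  calc ∑ i ∈ T \ S, g i ^ 2 ≤ ∑ i ∈ T \ S, (A / s) ^ (2 / p - 1) * |g i| ^ p :=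
        Finset.sum_le_sum fun i hi => hsq i (Finset.mem_sdiff.mp hi).2
    _ = (A / s) ^ (2 / p - 1) * ∑ i ∈ T \ S, |g i| ^ p := (Finset.mul_sum ..).symm
    _ ≤ (A / s) ^ (2 / p - 1) * A := by
        gcongr
        exact hg.sum_le_tsum _ fun i _ => hf0 i

/-- Stechkin bound for tensorized Chebyshev expansions. If
`∑_ν |g_ν|^p < ∞` with `0 < p < 2` and `F = ∑_ν g_ν T_ν` converges in `L²(U,η)`, then for
every `s ≥ 1` there is a set `S` of `s` indices with
`‖F - ∑_{ν ∈ S} g_ν T_ν‖_{L²} ≤ s^{1/2 - 1/p} (∑_ν |g_ν|^p)^{1/p}`. -/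
theorem stmt19 (p : ℝ) (hp0 : 0 < p) (hp2 : p < 2)
    (η : Measure (ℕ → ℝ)) (hη : IsChebProductMeasure η)
    (g : (ℕ →₀ ℕ) → ℝ) (hg : Summable fun ν => |g ν| ^ p)
    (TL : (ℕ →₀ ℕ) → Lp ℝ 2 η)
    (hTL : ∀ ν : ℕ →₀ ℕ,
      (TL ν : (ℕ → ℝ) → ℝ) =ᵐ[η] fun y => ∏ j ∈ ν.support, chebFun (ν j) (y j))
    (Ffun : Lp ℝ 2 η) (hF : HasSum (fun ν => g ν • TL ν) Ffun)
    (s : ℕ) (hs : 1 ≤ s) :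
    ∃ S : Finset (ℕ →₀ ℕ), S.card = s ∧
      ‖Ffun - ∑ ν ∈ S, g ν • TL ν‖ ≤
        (s : ℝ) ^ ((1 : ℝ) / 2 - 1 / p) * (∑' ν, |g ν| ^ p) ^ (1 / p) := by
  exact (hη.orthonormal hTL).exists_card_eq_norm_sub_sum_le hp0 hp2 hg hF hs
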